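/- If M is a stochastic matrix on K compatible with the recurrence structure, then for all p, p' ∈ Δ(K): S(pM, p'M) ≤ S(p, p'). -/

import Mathlib

/-- The `L¹` distance between two vectors indexed by a finite set. -/
noncomputable def dist1 {S : Type*} [Fintype S] (p p' : S → ℝ) : ℝ :=
  ∑ k, |p k - p' k|

/-- Row-vector times matrix multiplication, `(p A) k' = ∑ k, p k * A k k'`. -/
noncomputable def vecMulF {K : Type*} [Fintype K] (p : K → ℝ) (A : K → K → ℝ) : K → ℝ :=
  fun k' => ∑ k, p k * A k k'

/-- A recurrence structure on a finite set `K`: a partition of `K` into `R` nonempty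
classes (given by the class map `cls`, surjectivity expressing nonemptiness of classes),
together with, for each class `r`, a probability vector `pstar r ∈ Δ(K)` supported
in the class `r`. -/
structure RecStruct (K : Type*) [Fintype K] (R : ℕ) where
  cls : K → Fin R
  cls_surj : Function.Surjective cls
  pstar : Fin R → K → ℝ
  pstar_mem : ∀ r, pstar r ∈ stdSimplex ℝ K
  pstar_supp : ∀ r k, pstar r k ≠ 0 → cls k = r

namespace RecStruct

variable {K : Type*} [Fintype K] {R : ℕ}

/-- `lam rs p r` is the total mass given by `p` to the recurrence class `r`. -/
noncomputable def lam (rs : RecStruct K R) (p : K → ℝ) : Fin R → ℝ :=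
  fun r => ∑ k, if rs.cls k = r then p k else 0

/-- The conditional law of `p` given the recurrence class `r` (equal to `pstar r` when the
class has zero mass under `p`). -/
noncomputable def cond (rs : RecStruct K R) (p : K → ℝ) (r : Fin R) : K → ℝ :=
  if 0 < rs.lam p r then (fun k => if rs.cls k = r then p k / rs.lam p r else 0)
  else rs.pstar r

/-- The quantity `S(p,p') = ‖λ(p) - λ(p')‖₁ + ∑_{r : λ(p)^r λ(p')^r > 0} λ(p')^r ‖p_{|r} - p'_{|r}‖₁`. -/
noncomputable def Sdist (rs : RecStruct K R) (p p' : K → ℝ) : ℝ :=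
  dist1 (rs.lam p) (rs.lam p') +
    ∑ r, if 0 < rs.lam p r * rs.lam p' r
      then rs.lam p' r * dist1 (rs.cond p r) (rs.cond p' r) else 0

/-- The projection matrix `B`, whose row `k` is `pstar r` where `r` is the class of `k`. -/
noncomputable def Bmat (rs : RecStruct K R) : K → K → ℝ :=
  fun k k' => rs.pstar (rs.cls k) k'

/-- `P*`, the convex hull of the invariant measures of the classes. -/
noncomputable def Pset (rs : RecStruct K R) : Set (K → ℝ) :=
  convexHull ℝ (Set.range rs.pstar)

/-- `B^{-1}(p*) = {p ∈ Δ(K) : pB = p*}`. -/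
def Binv (rs : RecStruct K R) (pst : K → ℝ) : Set (K → ℝ) :=
  {p | p ∈ stdSimplex ℝ K ∧ vecMulF p rs.Bmat = pst}

/-- A stochastic matrix on `K` compatible with the recurrence structure: it is block
diagonal with respect to the partition and each `pstar r` is invariant. -/
structure IsCompatible (rs : RecStruct K R) (M : K → K → ℝ) : Prop where
  nonneg : ∀ k k', 0 ≤ M k k'
  rowSum : ∀ k, ∑ k', M k k' = 1
  block : ∀ k k', rs.cls k ≠ rs.cls k' → M k k' = 0
  invariant : ∀ r, vecMulF (rs.pstar r) M = rs.pstar r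

end RecStruct

/-- A stochastic matrix does not increase the `L¹` distance of row vectors. -/
theorem dist1_vecMulF_le {K : Type*} [Fintype K] {M : K → K → ℝ}
    (hnonneg : ∀ k k', 0 ≤ M k k') (hsum : ∀ k, ∑ k', M k k' = 1) (p p' : K → ℝ) :
    dist1 (vecMulF p M) (vecMulF p' M) ≤ dist1 p p' := by
  unfold dist1 vecMulF
  calc ∑ k', |∑ k, p k * M k k' - ∑ k, p' k * M k k'|
      ≤ ∑ k', ∑ k, |p k - p' k| * M k k' := by
        refine Finset.sum_le_sum fun k' _ => ?_
        rw [← Finset.sum_sub_distrib]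
        refine (Finset.abs_sum_le_sum_abs _ _).trans (le_of_eq ?_)
        refine Finset.sum_congr rfl fun k _ => ?_
        rw [← sub_mul, abs_mul, abs_of_nonneg (hnonneg k k')]
    _ = ∑ k, |p k - p' k| := by
        rw [Finset.sum_comm]
        simp_rw [← Finset.mul_sum, hsum, mul_one]

namespace RecStruct

/-- A compatible matrix preserves the mass of every recurrence class. -/
theorem IsCompatible.lam_vecMulF {K : Type*} [Fintype K] {R : ℕ} {rs : RecStruct K R}
    {M : K → K → ℝ} (hM : rs.IsCompatible M) (p : K → ℝ) :
    rs.lam (vecMulF p M) = rs.lam p := by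
  funext r
  have h : ∀ k k', (if rs.cls k' = r then p k * M k k' else 0)
      = (if rs.cls k = r then p k else 0) * M k k' := by
    intro k k'
    by_cases hk : rs.cls k = rs.cls k'
    · simp [hk]
    · simp [hM.block k k' hk]
  calc ∑ k', (if rs.cls k' = r then ∑ k, p k * M k k' else 0)
      = ∑ k', ∑ k, (if rs.cls k = r then p k else 0) * M k k' := by
        refine Finset.sum_congr rfl fun k' _ => ?_
        simp_rw [← h]
        split_ifs <;> simp
    _ = ∑ k, if rs.cls k = r then p k else 0 := by
        rw [Finset.sum_comm]
        simp_rw [← Finset.mul_sum, hM.rowSum, mul_one]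

/-- Conditioning on a recurrence class commutes with a compatible matrix. -/
theorem IsCompatible.cond_vecMulF {K : Type*} [Fintype K] {R : ℕ} {rs : RecStruct K R}
    {M : K → K → ℝ} (hM : rs.IsCompatible M) (p : K → ℝ) (r : Fin R) :
    rs.cond (vecMulF p M) r = vecMulF (rs.cond p r) M := by
  unfold cond
  rw [hM.lam_vecMulF]
  split_ifs with hr
  · funext k'
    simp only [vecMulF]
    split_ifs with hk'
    · rw [Finset.sum_div]
      refine Finset.sum_congr rfl fun k _ => ?_
      by_cases hk : rs.cls k = r
      · rw [if_pos hk]; ring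
      · simp [hM.block k k' (hk'.symm ▸ hk)]
    · refine (Finset.sum_eq_zero fun k _ => ?_).symm
      by_cases hk : rs.cls k = r
      · rw [hM.block k k' (hk.symm ▸ Ne.symm hk'), mul_zero]
      · simp [hk]
  · exact (hM.invariant r).symm

theorem lam_nonneg {K : Type*} [Fintype K] {R : ℕ} (rs : RecStruct K R) {p : K → ℝ}
    (hp : ∀ k, 0 ≤ p k) (r : Fin R) : 0 ≤ rs.lam p r := by
  refine Finset.sum_nonneg fun k _ => ?_
  split_ifs
  exacts [hp k, le_rfl]

end RecStruct

/-- **Lemma `propertiesS`, part 2.** If `M` is a stochastic matrix on `K` compatible with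
the recurrence structure, then `S(pM, p'M) ≤ S(p, p')` for all `p, p' ∈ Δ(K)`. -/
theorem Sdist_vecMul_le {K : Type*} [Fintype K] {R : ℕ}
    (rs : RecStruct K R) (M : K → K → ℝ) (hM : rs.IsCompatible M)
    (p p' : K → ℝ) (hp : p ∈ stdSimplex ℝ K) (hp' : p' ∈ stdSimplex ℝ K) :
    rs.Sdist (vecMulF p M) (vecMulF p' M) ≤ rs.Sdist p p' := by
  unfold RecStruct.Sdist
  simp only [hM.lam_vecMulF, hM.cond_vecMulF]
  gcongr with r
  split_ifs
  · exact mul_le_mul_of_nonneg_left (dist1_vecMulF_le hM.nonneg hM.rowSum _ _)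
      (rs.lam_nonneg hp'.1 r)
  · exact le_rfl
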